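/- arXiv:2105.04712 — 2 statements merged into one kernel-verified Lean document; each statement's English description precedes it below -/
import Mathlib

section
/- There exists a universal constant C such that for all reals p ≥ q ≥ 1, every d ≥ 1, and all x, y ∈ ℝ^d, ‖M̃_{p,q}(x) − M̃_{p,q}(y)‖_q ≤ C·(p/q)·‖x − y‖_p; that is, the rescaled Mazur map, viewed as a map from ℓ_p^d to ℓ_q^d, is Lipschitz on all of ℝ^d with Lipschitz constant O(p/q). -/
/-- The ℓ_p norm on ℝ^d (for a real exponent p). -/
noncomputable def lpNorm (p : ℝ) {d : ℕ} (x : Fin d → ℝ) : ℝ :=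
  (∑ i, |x i| ^ p) ^ (1 / p)

/-- The Mazur map `M_{p,q}`, defined coordinatewise by
`M_{p,q}(x)_i = sign(x_i) |x_i|^(p/q)`. -/
noncomputable def mazurMap (p q : ℝ) {d : ℕ} (x : Fin d → ℝ) : Fin d → ℝ :=
  fun i => Real.sign (x i) * |x i| ^ (p / q)

/-- The rescaled Mazur map `M̃_{p,q}(x) = ‖x‖_p^{1-p/q} M_{p,q}(x)`, with
`M̃_{p,q}(0) = 0`. -/
noncomputable def rescaledMazurMap (p q : ℝ) {d : ℕ} (x : Fin d → ℝ) : Fin d → ℝ :=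
  if x = 0 then 0 else lpNorm p x ^ (1 - p / q) • mazurMap p q x


lemma aux_nonneg (p : ℝ) {d : ℕ} (x : Fin d → ℝ) : 0 ≤ lpNorm p x := by
  unfold lpNorm; positivity

lemma aux_pos (p : ℝ) {d : ℕ} (x : Fin d → ℝ) (hx : x ≠ 0) : 0 < lpNorm p x := by
  unfold lpNorm
  apply Real.rpow_pos_of_pos
  obtain ⟨i, hi⟩ := Function.ne_iff.mp hx
  have : 0 < |x i| ^ p := Real.rpow_pos_of_pos (abs_pos.mpr hi) _
  exact lt_of_lt_of_le this
    (Finset.single_le_sum (f := fun i => |x i| ^ p) (fun j _ => by positivity) (Finset.mem_univ i))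

lemma aux_zero (p : ℝ) (hp : 1 ≤ p) {d : ℕ} : lpNorm p (0 : Fin d → ℝ) = 0 := by
  have h1 : p ≠ 0 := by positivity
  simp [lpNorm, Real.zero_rpow h1, h1]

lemma aux_mono (p : ℝ) (hp : 1 ≤ p) {d : ℕ} (x y : Fin d → ℝ) (h : ∀ i, |x i| ≤ |y i|) :
    lpNorm p x ≤ lpNorm p y := by
  unfold lpNorm
  have : 0 ≤ p := by linarith
  refine Real.rpow_le_rpow (by positivity) (Finset.sum_le_sum fun i _ => ?_) (by positivity)
  exact Real.rpow_le_rpow (abs_nonneg _) (h i) this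

lemma aux_smul (p : ℝ) (hp : 1 ≤ p) {d : ℕ} (c : ℝ) (x : Fin d → ℝ) :
    lpNorm p (c • x) = |c| * lpNorm p x := by
  have h1 : p ≠ 0 := by positivity
  unfold lpNorm
  simp only [Pi.smul_apply, smul_eq_mul, abs_mul]
  simp_rw [Real.mul_rpow (abs_nonneg _) (abs_nonneg _)]
  rw [← Finset.mul_sum, Real.mul_rpow (by positivity) (by positivity), ← Real.rpow_mul (abs_nonneg _),
    mul_one_div_cancel h1, Real.rpow_one]

lemma aux_add (p : ℝ) (hp : 1 ≤ p) {d : ℕ} (x y : Fin d → ℝ) :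
    lpNorm p (x + y) ≤ lpNorm p x + lpNorm p y :=
  Real.Lp_add_le Finset.univ x y hp

lemma aux_comm (p : ℝ) {d : ℕ} (x y : Fin d → ℝ) :
    lpNorm p (x - y) = lpNorm p (y - x) := by
  simp [lpNorm, abs_sub_comm]

lemma aux_mazur_abs (r : ℝ) (hr : 1 ≤ r) (u : ℝ) : |Real.sign u * |u| ^ r| = |u| ^ r := by
  rcases eq_or_ne u 0 with rfl | h
  · simp [Real.zero_rpow (by positivity : r ≠ 0)]
  · rcases Real.sign_apply_eq_of_ne_zero u h with h | h <;> simp [h, abs_of_nonneg, Real.rpow_nonneg]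

lemma aux_mazur_norm (p q : ℝ) (hq : 1 ≤ q) (hpq : q ≤ p) {d : ℕ} (x : Fin d → ℝ) :
    lpNorm q (mazurMap p q x) = lpNorm p x ^ (p / q) := by
  have hq0 : 0 < q := by linarith
  have hp0 : 0 < p := by linarith
  have hr : 1 ≤ p / q := by rwa [one_le_div hq0]
  unfold lpNorm mazurMap
  simp_rw [aux_mazur_abs _ hr, ← Real.rpow_mul (abs_nonneg _)]
  rw [← Real.rpow_mul (by positivity)]
  congr 2
  · ext i
    congr 1
    field_simp
  · field_simp

/-- Bernoulli in homogeneous form. -/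
lemma aux_bern (r : ℝ) (hr : 1 ≤ r) (u v : ℝ) (hu : 0 < u) (hv : 0 ≤ v) :
    u ^ r - v ^ r ≤ r * (u - v) * u ^ (r - 1) := by
  have h := one_add_mul_self_le_rpow_one_add (s := v / u - 1)
    (by have : 0 ≤ v / u := by positivity
        linarith) hr
  have h2 : 1 + (v / u - 1) = v / u := by ring
  rw [h2, Real.div_rpow hv hu.le, le_div_iff₀ (by positivity)] at h
  have h3 : u ^ r = u * u ^ (r - 1) := by
    rw [Real.rpow_sub_one hu.ne']; field_simp
  have h4 : (1 + r * (v / u - 1)) * u ^ r = u ^ r + r * (v - u) * u ^ (r-1) := by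
    rw [h3]; field_simp
  rw [h4] at h
  linarith

lemma aux_pt_pos (r : ℝ) (hr : 1 < r) (u v : ℝ) (hv : 0 ≤ v) (huv : v ≤ u) :
    |u ^ r - v ^ r| ≤ r * (|u - v| * (u ^ (r - 1) + v ^ (r - 1))) := by
  rcases hv.eq_or_lt with rfl | hv'
  · rcases huv.eq_or_lt with rfl | hu
    · simp
    · have := aux_bern r hr.le u 0 hu le_rfl
      have h1 : (0:ℝ) ^ r ≤ u ^ r := by gcongr
      rw [abs_of_nonneg (by linarith), abs_of_nonneg (by linarith)]
      have h2 : (0:ℝ) ^ (r-1) = 0 := Real.zero_rpow (by linarith)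
      rw [h2]
      linarith
  · have hu : 0 < u := by linarith
    have := aux_bern r hr.le u v hu hv
    have h1 : v ^ r ≤ u ^ r := by gcongr
    rw [abs_of_nonneg (by linarith), abs_of_nonneg (by linarith)]
    have : 0 ≤ r * (u - v) * v ^ (r - 1) :=
      mul_nonneg (mul_nonneg (by linarith) (by linarith)) (by positivity)
    nlinarith

lemma aux_pt_pos' (r : ℝ) (hr : 1 < r) (u v : ℝ) (hu : 0 ≤ u) (hv : 0 ≤ v) :
    |u ^ r - v ^ r| ≤ r * (|u - v| * (u ^ (r - 1) + v ^ (r - 1))) := by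
  rcases le_total v u with h | h
  · exact aux_pt_pos r hr u v hv h
  · rw [abs_sub_comm, abs_sub_comm u v, add_comm]
    exact aux_pt_pos r hr v u hu h

lemma aux_opp (r : ℝ) (hr : 1 < r) (u v : ℝ) (hu : 0 ≤ u) (hv : 0 ≤ v) :
    u ^ r + v ^ r ≤ r * ((u + v) * (u ^ (r - 1) + v ^ (r - 1))) := by
  have h3 : ∀ w : ℝ, 0 ≤ w → w ^ r = w * w ^ (r - 1) := by
    intro w hw
    rcases hw.eq_or_lt with rfl | hw
    · simp [Real.zero_rpow (by linarith : r ≠ 0)]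
    · rw [Real.rpow_sub_one hw.ne']; field_simp
  rw [h3 u hu, h3 v hv]
  have a : 0 ≤ u ^ (r-1) := by positivity
  have b : 0 ≤ v ^ (r-1) := by positivity
  have h : u * u ^ (r - 1) + v * v ^ (r - 1) ≤ (u + v) * (u ^ (r - 1) + v ^ (r - 1)) := by
    nlinarith [mul_nonneg hu b, mul_nonneg hv a]
  have h0 : 0 ≤ (u + v) * (u ^ (r - 1) + v ^ (r - 1)) := by positivity
  nlinarith

lemma aux_sgn_nonneg (r : ℝ) (hr : 1 < r) (u : ℝ) (hu : 0 ≤ u) :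
    Real.sign u * |u| ^ r = u ^ r := by
  rcases hu.eq_or_lt with rfl | h
  · simp [Real.zero_rpow (by linarith : r ≠ 0)]
  · rw [Real.sign_of_pos h, abs_of_pos h, one_mul]

lemma aux_sgn_nonpos (r : ℝ) (hr : 1 < r) (u : ℝ) (hu : u ≤ 0) :
    Real.sign u * |u| ^ r = - (-u) ^ r := by
  rcases hu.eq_or_lt with rfl | h
  · simp [Real.zero_rpow (by linarith : r ≠ 0)]
  · rw [Real.sign_of_neg h, abs_of_neg h, neg_one_mul]

lemma aux_pt (r : ℝ) (hr : 1 < r) (u v : ℝ) :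
    |Real.sign u * |u| ^ r - Real.sign v * |v| ^ r| ≤
      r * (|u - v| * (|u| ^ (r - 1) + |v| ^ (r - 1))) := by
  rcases le_total 0 u with hu | hu <;> rcases le_total 0 v with hv | hv
  · rw [aux_sgn_nonneg r hr u hu, aux_sgn_nonneg r hr v hv, abs_of_nonneg hu, abs_of_nonneg hv]
    exact aux_pt_pos' r hr u v hu hv
  · rw [aux_sgn_nonneg r hr u hu, aux_sgn_nonpos r hr v hv, abs_of_nonneg hu, abs_of_nonpos hv]
    have := aux_opp r hr u (-v) hu (by linarith)
    have e : 0 ≤ (-v) ^ r := Real.rpow_nonneg (by linarith) _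
    rw [abs_of_nonneg (by linarith : 0 ≤ u - v), abs_of_nonneg (by rw [sub_neg_eq_add]; positivity)]
    rw [sub_neg_eq_add, sub_eq_add_neg u v]
    exact this
  · rw [aux_sgn_nonpos r hr u hu, aux_sgn_nonneg r hr v hv, abs_of_nonpos hu, abs_of_nonneg hv]
    have := aux_opp r hr (-u) v (by linarith) hv
    have e : 0 ≤ (-u) ^ r := Real.rpow_nonneg (by linarith) _
    have e2 : 0 ≤ v ^ r := Real.rpow_nonneg (by linarith) _
    rw [abs_of_nonpos (by linarith : u - v ≤ 0), abs_of_nonpos (by linarith)]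
    have e3 : -(u - v) = -u + v := by ring
    rw [e3]
    linarith
  · rw [aux_sgn_nonpos r hr u hu, aux_sgn_nonpos r hr v hv, abs_of_nonpos hu, abs_of_nonpos hv]
    have := aux_pt_pos' r hr (-u) (-v) (by linarith) (by linarith)
    rw [abs_sub_comm u v]
    rw [abs_sub_comm] at this
    convert this using 2
    · ring
    · congr 2; ring

lemma aux_holder (p q : ℝ) (hq : 1 ≤ q) (hpq : q < p) {d : ℕ} (z x : Fin d → ℝ) :
    lpNorm q (fun i => |z i| * |x i| ^ (p / q - 1)) ≤ lpNorm p z * lpNorm p x ^ (p / q - 1) := by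
  have hq0 : 0 < q := by linarith
  have hp0 : 0 < p := by linarith
  have hd : 0 < p - q := by linarith
  have hc : (p / q).HolderConjugate (p / (p - q)) := by
    rw [Real.holderConjugate_iff]
    constructor
    · rwa [one_lt_div hq0]
    · field_simp; ring
  have H := Real.inner_le_Lp_mul_Lq_of_nonneg Finset.univ (f := fun i => |z i| ^ q)
    (g := fun i => (|x i| ^ (p / q - 1)) ^ q) hc (fun i _ => by positivity) (fun i _ => by positivity)
  have e1 : ∀ i, (|z i| ^ q) ^ (p / q) = |z i| ^ p := fun i => by
    rw [← Real.rpow_mul (abs_nonneg _)]; congr 1; field_simp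
  have e2 : ∀ i, ((|x i| ^ (p / q - 1)) ^ q) ^ (p / (p - q)) = |x i| ^ p := fun i => by
    rw [← Real.rpow_mul (abs_nonneg _), ← Real.rpow_mul (abs_nonneg _)]; congr 1; field_simp
  simp_rw [e1, e2] at H
  unfold lpNorm
  have e3 : ∀ i, |(|z i| * |x i| ^ (p / q - 1))| ^ q = |z i| ^ q * (|x i| ^ (p / q - 1)) ^ q :=
    fun i => by rw [abs_of_nonneg (by positivity), Real.mul_rpow (by positivity) (by positivity)]
  simp_rw [e3]
  refine (Real.rpow_le_rpow (by positivity) H (by positivity)).trans (le_of_eq ?_)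
  rw [Real.mul_rpow (by positivity) (by positivity), ← Real.rpow_mul (by positivity),
    ← Real.rpow_mul (by positivity), ← Real.rpow_mul (by positivity)]
  congr 2 <;> field_simp

lemma aux_main (p q : ℝ) (hq : 1 ≤ q) (hpq : q < p) {d : ℕ} (x y : Fin d → ℝ)
    (hx : x ≠ 0) (hy : y ≠ 0) (hxy : lpNorm p y ≤ lpNorm p x) :
    lpNorm q (rescaledMazurMap p q x - rescaledMazurMap p q y) ≤
      3 * (p / q) * lpNorm p (x - y) := by
  have hq0 : 0 < q := by linarith
  have hp1 : 1 ≤ p := by linarith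
  have hr : 1 < p / q := by rwa [one_lt_div hq0]
  have hN := aux_mazur_norm p q hq hpq.le y
  have ha := aux_pos p x hx
  have hb := aux_pos p y hy
  have hH1 := aux_holder p q hq hpq (x - y) x
  have hH2 := aux_holder p q hq hpq (x - y) y
  have htri : lpNorm p x - lpNorm p y ≤ lpNorm p (x - y) := by
    have := aux_add p hp1 (x - y) y
    rw [sub_add_cancel] at this
    linarith
  have hz := aux_nonneg p (x - y)
  have hM : lpNorm q (mazurMap p q x - mazurMap p q y) ≤
      (p / q) * (lpNorm p (x - y) * lpNorm p x ^ (p / q - 1) +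
        lpNorm p (x - y) * lpNorm p y ^ (p / q - 1)) := by
    refine le_trans (aux_mono q hq _ ((p / q) •
      ((fun i => |(x - y) i| * |x i| ^ (p / q - 1)) +
        (fun i => |(x - y) i| * |y i| ^ (p / q - 1)))) ?_) ?_
    · intro i
      refine (aux_pt (p / q) hr (x i) (y i)).trans (le_trans (le_of_eq ?_) (le_abs_self _))
      simp only [Pi.smul_apply, Pi.add_apply, Pi.sub_apply, smul_eq_mul]
      ring
    · rw [aux_smul q hq, abs_of_pos (by linarith)]
      gcongr
      exact (aux_add q hq _ _).trans (add_le_add hH1 hH2)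
  have hdec : rescaledMazurMap p q x - rescaledMazurMap p q y =
      lpNorm p x ^ (1 - p / q) • (mazurMap p q x - mazurMap p q y) +
      (lpNorm p x ^ (1 - p / q) - lpNorm p y ^ (1 - p / q)) • mazurMap p q y := by
    simp only [rescaledMazurMap, if_neg hx, if_neg hy, smul_sub, sub_smul]
    abel
  rw [hdec]
  refine (aux_add q hq _ _).trans ?_
  rw [aux_smul q hq, aux_smul q hq, hN]
  generalize lpNorm p x = a at *
  generalize lpNorm p y = b at *
  generalize lpNorm p (x - y) = c at *
  generalize p / q = r at *
  have hA : 0 < a ^ (1 - r) := by positivity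
  have hmul : a ^ (1 - r) * a ^ (r - 1) = 1 := by
    rw [← Real.rpow_add ha]; simp
  have hbr : b ^ (1 - r) * b ^ r = b := by
    rw [← Real.rpow_add hb]; simp
  have har : a ^ (1 - r) * a ^ r = a := by
    rw [← Real.rpow_add ha]; simp
  have hpow : b ^ (r - 1) ≤ a ^ (r - 1) := by
    gcongr
  have hneg : a ^ (1 - r) ≤ b ^ (1 - r) :=
    Real.rpow_le_rpow_of_nonpos hb hxy (by linarith)
  rw [abs_of_pos hA, abs_of_nonpos (by linarith)]
  have hB := aux_bern r hr.le a b ha hb.le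
  have hB2 := mul_le_mul_of_nonneg_left hB hA.le
  have e1 : a ^ (1 - r) * (r * (a - b) * a ^ (r - 1)) = r * (a - b) := by
    linear_combination (r * (a - b)) * hmul
  have t2 : -(a ^ (1 - r) - b ^ (1 - r)) * b ^ r ≤ r * c := by
    have : r * (a - b) ≤ r * c := by gcongr
    nlinarith
  have t1 : a ^ (1 - r) * (r * (c * a ^ (r - 1) + c * b ^ (r - 1))) ≤ 2 * r * c := by
    calc _ ≤ a ^ (1 - r) * (r * (c * a ^ (r - 1) + c * a ^ (r - 1))) := by gcongr
      _ = 2 * r * c := by linear_combination (2 * r * c) * hmul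
  have t3 := mul_le_mul_of_nonneg_left hM hA.le
  linarith

lemma aux_resc_norm (p q : ℝ) (hq : 1 ≤ q) (hpq : q ≤ p) {d : ℕ} (x : Fin d → ℝ) :
    lpNorm q (rescaledMazurMap p q x) = lpNorm p x := by
  by_cases hx : x = 0
  · simp [rescaledMazurMap, hx, aux_zero q hq, aux_zero p (hq.trans hpq)]
  · have ha := aux_pos p x hx
    rw [rescaledMazurMap, if_neg hx, aux_smul q hq, aux_mazur_norm p q hq hpq,
      abs_of_pos (by positivity), ← Real.rpow_add ha]
    simp

lemma aux_id (q : ℝ) (hq : 1 ≤ q) {d : ℕ} (x : Fin d → ℝ) : rescaledMazurMap q q x = x := by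
  unfold rescaledMazurMap
  split_ifs with h
  · exact h.symm
  · ext i
    have h1 : q / q = 1 := div_self (by linarith)
    simp only [mazurMap, h1, Pi.smul_apply, sub_self, Real.rpow_zero, Real.rpow_one, one_smul]
    rcases lt_trichotomy (x i) 0 with h | h | h
    · simp [Real.sign_of_neg h, abs_of_neg h]
    · simp [h]
    · simp [Real.sign_of_pos h, abs_of_pos h]

/-- The rescaled Mazur map, viewed as a map from ℓ_p^d to ℓ_q^d, is Lipschitz on
all of ℝ^d with Lipschitz constant O(p/q). -/
theorem stmt1 :
    ∃ C : ℝ, 0 < C ∧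
      ∀ (p q : ℝ), 1 ≤ q → q ≤ p →
      ∀ (d : ℕ), 1 ≤ d →
      ∀ x y : Fin d → ℝ,
        lpNorm q (rescaledMazurMap p q x - rescaledMazurMap p q y) ≤
          C * (p / q) * lpNorm p (x - y) := by
  refine ⟨3, by norm_num, ?_⟩
  intro p q hq hpq d _ x y
  have hr : 1 ≤ p / q := by rwa [one_le_div (by linarith)]
  have hz := aux_nonneg p (x - y)
  have triv : lpNorm p (x - y) ≤ 3 * (p / q) * lpNorm p (x - y) :=
    le_mul_of_one_le_left hz (by linarith)
  rcases hpq.eq_or_lt with rfl | hlt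
  · rw [aux_id q hq, aux_id q hq]
    exact triv
  by_cases hx : x = 0
  · have h0 : rescaledMazurMap p q x = 0 := by simp [rescaledMazurMap, hx]
    rw [aux_comm q, h0, sub_zero, aux_resc_norm p q hq hpq]
    refine le_trans (le_of_eq ?_) triv
    rw [aux_comm, hx, sub_zero]
  by_cases hy : y = 0
  · have h0 : rescaledMazurMap p q y = 0 := by simp [rescaledMazurMap, hy]
    rw [h0, sub_zero, aux_resc_norm p q hq hpq]
    refine le_trans (le_of_eq ?_) triv
    rw [hy, sub_zero]
  rcases le_total (lpNorm p y) (lpNorm p x) with h | h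
  · exact aux_main p q hq hlt x y hx hy h
  · rw [aux_comm q, aux_comm p]
    exact aux_main p q hq hlt y x hy hx h
end

section
/- For all α, β ∈ (0,1] and K, L > 0 there exists a constant M = M(K, L, α, β) > 0 such that the following holds. Let X and Y be finite-dimensional real normed spaces and let f : S_X → S_Y be a bijection between the unit spheres satisfying (1/L)·‖x − y‖_X^{1/β} ≤ ‖f(x) − f(y)‖_Y ≤ K·‖x − y‖_X^α for all x, y ∈ S_X; let f̃ be the degree-α radial extension of f. Then for every finite nonempty set P ⊆ X of n points: (a) there exists t ∈ X with (1/n) Σ_{x∈P} f̃(x − t) = 0; and (b) every t ∈ X with (1/n) Σ_{x∈P} f̃(x − t) = 0 satisfies ‖t‖_X ≤ ((M/n) Σ_{x∈P} ‖x‖_X^α)^{1/α}. -/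
open scoped Classical
open Finset

universe u v

/-- The degree-`p` radial extension of a map `g` between unit spheres:
`g̃(x) = ‖x‖^p · g(x/‖x‖)` for `x ≠ 0`, and `g̃(0) = 0`. -/
noncomputable def radialExt {U V : Type*} [NormedAddCommGroup U] [NormedSpace ℝ U]
    [NormedAddCommGroup V] [NormedSpace ℝ V] (p : ℝ) (g : U → V) (x : U) : V :=
  if x = 0 then 0 else ‖x‖ ^ p • g (‖x‖⁻¹ • x)

lemma aux_det_poly {E : Type*} [NormedAddCommGroup E] [NormedSpace ℝ E] [FiniteDimensional ℝ E]
    (v : ℕ → ℝ) (hv : Function.Injective v) :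
    ∃ w : ℕ → ℝ, ∃ S : Finset ℕ, ∑ i ∈ S, w i = 1 ∧ ∀ A : E →L[ℝ] E,
      (1 + A).det = ∑ i ∈ S, w i * (1 + v i • A).det := by
  set n := Module.finrank ℝ E
  set S := Finset.range (n + 1)
  have hS : Set.InjOn v S := hv.injOn
  refine ⟨fun i => (Lagrange.basis S v i).eval 1, S, ?_, ?_⟩
  · rw [← Polynomial.eval_finsetSum, Lagrange.sum_basis hS ⟨0, by simp [S]⟩, Polynomial.eval_one]
  · intro A
    let b := Module.finBasis ℝ E
    let B := LinearMap.toMatrix b b (A : E →ₗ[ℝ] E)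
    let q : Polynomial ℝ := Matrix.det ((Polynomial.X : Polynomial ℝ) • B.map Polynomial.C
      + (1 : Matrix _ _ ℝ).map Polynomial.C)
    have hq : ∀ s : ℝ, (1 + s • A).det = q.eval s := by
      intro s
      have h1 : (1 + s • A).det = Matrix.det (1 + s • B) := by
        change LinearMap.det _ = _
        rw [← LinearMap.det_toMatrix b]
        congr 1
        change LinearMap.toMatrix b b (LinearMap.id + s • (A : E →ₗ[ℝ] E)) = _
        rw [map_add, map_smul, LinearMap.toMatrix_id]
      rw [h1]
      simp only [q]
      rw [← Polynomial.coe_evalRingHom, RingHom.map_det]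
      congr 1
      ext i j
      simp [Matrix.one_apply, add_comm]
      split_ifs <;> simp [mul_comm]
    have hd : q.degree < S.card := by
      refine lt_of_le_of_lt Polynomial.degree_le_natDegree ?_
      have := Polynomial.natDegree_det_X_add_C_le B 1
      have h2 : q.natDegree ≤ n := by rwa [Fintype.card_fin] at this
      simp only [S, Finset.card_range]
      exact_mod_cast Nat.lt_succ_of_le h2
    have h3 := Lagrange.eq_interpolate hS hd
    have h4 := hq 1
    rw [one_smul] at h4
    rw [h4]
    conv_lhs => rw [h3]
    rw [Lagrange.interpolate_apply, Polynomial.eval_finsetSum]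
    refine Finset.sum_congr rfl fun i _ => ?_
    rw [hq]
    simp [mul_comm]

lemma aux_vol {E : Type*} [NormedAddCommGroup E] [InnerProductSpace ℝ E] [FiniteDimensional ℝ E]
    [MeasurableSpace E] [BorelSpace E] (r : E → E) (hr : ContDiff ℝ 1 r) (R : ℝ) (hR : 0 < R)
    (hrR : ∀ x, ‖r x‖ = R) (hid : ∀ x, ‖x‖ = R → r x = x) (C s : ℝ) (hs0 : 0 < s) (hs1 : s < 1)
    (hC : ∀ x ∈ Metric.closedBall (0 : E) R, ‖fderiv ℝ r x - 1‖ ≤ C) (hsC : s * C < 1)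
    (hdet : ∀ x ∈ Metric.closedBall (0 : E) R, 0 < (1 + s • (fderiv ℝ r x - 1)).det) :
    ∫ x in Metric.ball (0 : E) R, (1 + s • (fderiv ℝ r x - 1)).det
      = MeasureTheory.volume.real (Metric.ball (0 : E) R) := by
  let f : E → E := fun x => x + s • (r x - x)
  have hrd : Differentiable ℝ r := hr.differentiable (by norm_num)
  have hfs : ContDiff ℝ 1 f := by fun_prop
  have hf' : ∀ x, HasFDerivAt f (1 + s • (fderiv ℝ r x - 1)) x := fun x =>
    (hasFDerivAt_id x).add (((hrd x).hasFDerivAt.sub (hasFDerivAt_id x)).const_smul s)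
  have hmap : ∀ x ∈ Metric.ball (0 : E) R, f x ∈ Metric.ball (0 : E) R := by
    intro x hx
    rw [mem_ball_zero_iff] at hx ⊢
    have : f x = (1 - s) • x + s • r x := by simp only [f]; module
    rw [this]
    calc _ ≤ ‖(1 - s) • x‖ + ‖s • r x‖ := norm_add_le _ _
      _ = (1 - s) * ‖x‖ + s * R := by
        rw [norm_smul, norm_smul, hrR, Real.norm_of_nonneg hs0.le, Real.norm_of_nonneg (by linarith)]
      _ < R := by nlinarith
  have hinj : Set.InjOn f (Metric.ball (0 : E) R) := by
    intro x hx y hy hxy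
    have hL := (convex_closedBall (0 : E) R).norm_image_sub_le_of_norm_hasFDerivWithin_le
      (f := fun x => r x - x) (f' := fun x => fderiv ℝ r x - 1) (C := C)
      (fun z _ => ((hrd z).hasFDerivAt.sub (hasFDerivAt_id z)).hasFDerivWithinAt) hC
      (Metric.ball_subset_closedBall hx) (Metric.ball_subset_closedBall hy)
    have h1 : y - x = -(s • ((r y - y) - (r x - x))) := by
      simp only [f] at hxy
      rw [smul_sub, neg_sub, sub_eq_sub_iff_add_eq_add, ← hxy, add_comm]
    have h2 : ‖y - x‖ ≤ s * (C * ‖y - x‖) := by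
      calc ‖y - x‖ = s * ‖(r y - y) - (r x - x)‖ := by
            conv_lhs => rw [h1]
            rw [norm_neg, norm_smul, Real.norm_of_nonneg hs0.le]
        _ ≤ _ := by gcongr
    have h3 : ‖y - x‖ = 0 := by nlinarith [norm_nonneg (y - x)]
    exact (sub_eq_zero.mp (norm_eq_zero.mp h3)).symm
  have hopen : IsOpen (f '' Metric.ball (0 : E) R) := by
    rw [isOpen_iff_mem_nhds]
    rintro _ ⟨x, hx, rfl⟩
    have hst : HasStrictFDerivAt f (1 + s • (fderiv ℝ r x - 1)) x :=
      hfs.contDiffAt.hasStrictFDerivAt' (hf' x) (by norm_num)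
    have hd := hdet x (Metric.ball_subset_closedBall hx)
    have := hst.map_nhds_eq_of_surj (by
      by_contra hne
      have : LinearMap.det ((1 + s • (fderiv ℝ r x - 1) : E →L[ℝ] E) : E →ₗ[ℝ] E) ≠ 0 := hd.ne'
      exact hne (LinearMap.range_eq_top.mpr
        (LinearMap.equivOfDetNeZero _ this).surjective))
    rw [← this]
    exact Filter.image_mem_map (Metric.isOpen_ball.mem_nhds hx)
  have himg : f '' Metric.ball (0 : E) R = Metric.ball (0 : E) R := by
    apply Set.Subset.antisymm
    · rintro _ ⟨x, hx, rfl⟩; exact hmap x hx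
    · refine (convex_ball (0 : E) R).isPreconnected.subset_of_closure_inter_subset hopen
        ⟨f 0, hmap 0 (by simpa), 0, by simpa, rfl⟩ ?_
      rintro y ⟨hy, hyb⟩
      have hcl : closure (f '' Metric.ball (0 : E) R) ⊆ f '' Metric.closedBall (0 : E) R :=
        closure_minimal (Set.image_mono Metric.ball_subset_closedBall)
          ((isCompact_closedBall (0 : E) R).image hfs.continuous).isClosed
      obtain ⟨x, hx, rfl⟩ := hcl hy
      refine ⟨x, ?_, rfl⟩
      rw [mem_closedBall_zero_iff] at hx
      rw [mem_ball_zero_iff]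
      refine lt_of_le_of_ne hx fun h => ?_
      have : f x = x := by simp [f, hid x h]
      rw [this, mem_ball_zero_iff] at hyb
      exact hyb.ne h
  have key := MeasureTheory.integral_image_eq_integral_abs_det_fderiv_smul
    MeasureTheory.volume (Metric.isOpen_ball (x := (0 : E)) (ε := R)).measurableSet
    (fun x _ => (hf' x).hasFDerivWithinAt) hinj (fun _ => (1 : ℝ))
  rw [himg] at key
  simp only [smul_eq_mul, mul_one, MeasureTheory.setIntegral_const] at key
  rw [key]
  refine MeasureTheory.setIntegral_congr_fun Metric.isOpen_ball.measurableSet fun x hx => ?_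
  exact (abs_of_pos (hdet x (Metric.ball_subset_closedBall hx))).symm

lemma aux_noretract {E : Type*} [NormedAddCommGroup E] [InnerProductSpace ℝ E]
    [FiniteDimensional ℝ E] [MeasurableSpace E] [BorelSpace E]
    (r : E → E) (hr : ContDiff ℝ 1 r) (R : ℝ) (hR : 0 < R)
    (hrR : ∀ x, ‖r x‖ = R) (hid : ∀ x, ‖x‖ = R → r x = x) : False := by
  have hrd : Differentiable ℝ r := hr.differentiable (by norm_num)
  have hcont : Continuous (fun x => fderiv ℝ r x - 1) :=
    (hr.continuous_fderiv (by norm_num)).sub continuous_const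
  obtain ⟨C, hC⟩ := (isCompact_closedBall (0 : E) R).exists_bound_of_continuousOn hcont.continuousOn
  have hC0 : 0 ≤ C := (norm_nonneg _).trans (hC 0 (by simp [hR.le]))
  have hdet1 : ∃ δ > 0, ∀ A : E →L[ℝ] E, ‖A‖ < δ → 0 < (1 + A).det := by
    have hc : Continuous (fun A : E →L[ℝ] E => (1 + A).det) :=
      ContinuousLinearMap.continuous_det.comp (continuous_const.add continuous_id)
    have h0 : 0 < (1 + (0 : E →L[ℝ] E)).det := by
      rw [add_zero]
      change 0 < LinearMap.det (LinearMap.id : E →ₗ[ℝ] E)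
      simp
    obtain ⟨δ, hδ, h⟩ := Metric.eventually_nhds_iff.mp ((hc.tendsto 0).eventually_const_lt h0)
    exact ⟨δ, hδ, fun A hA => h (by simpa using hA)⟩
  obtain ⟨δ, hδ, hdet⟩ := hdet1
  obtain ⟨ε, hε0, hε1, hε2, hε3⟩ : ∃ ε : ℝ, 0 < ε ∧ ε < 1 ∧ ε * C < 1 ∧ ε * C < δ := by
    refine ⟨min 1 δ / (2 * (C + 1)), by positivity, ?_, ?_, ?_⟩
    · rw [div_lt_one (by positivity)]; have := min_le_left 1 δ; linarith
    · rw [div_mul_eq_mul_div, div_lt_one (by positivity)]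
      have := min_le_left 1 δ; nlinarith
    · rw [div_mul_eq_mul_div, div_lt_iff₀ (by positivity)]
      have := min_le_right 1 δ; nlinarith
  let v : ℕ → ℝ := fun i => ε / (i + 1)
  have hv : Function.Injective v := by
    intro i j hij
    simp only [v] at hij
    have h1 : (i : ℝ) + 1 ≠ 0 := by positivity
    have h2 : (j : ℝ) + 1 ≠ 0 := by positivity
    rw [div_eq_div_iff h1 h2] at hij
    have := mul_left_cancel₀ hε0.ne' hij
    exact_mod_cast (add_right_cancel this).symm
  have hv0 : ∀ i, 0 < v i := fun i => by simp only [v]; positivity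
  have hvε : ∀ i, v i ≤ ε := fun i => by
    simp only [v]; apply div_le_self hε0.le; linarith [(Nat.cast_nonneg i : (0 : ℝ) ≤ i)]
  obtain ⟨w, S, hw, hpoly⟩ := aux_det_poly (E := E) v hv
  have hvol : ∀ i, ∫ x in Metric.ball (0 : E) R, (1 + v i • (fderiv ℝ r x - 1)).det
      = MeasureTheory.volume.real (Metric.ball (0 : E) R) := by
    intro i
    have h1 : v i * C ≤ ε * C := mul_le_mul_of_nonneg_right (hvε i) hC0
    refine aux_vol r hr R hR hrR hid C (v i) (hv0 i) ((hvε i).trans_lt hε1) hC (h1.trans_lt hε2) ?_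
    intro x hx
    apply hdet
    rw [norm_smul, Real.norm_of_nonneg (hv0 i).le]
    exact (mul_le_mul_of_nonneg_left (hC x hx) (hv0 i).le).trans_lt (h1.trans_lt hε3)
  have hzero : ∀ x, (1 + (fderiv ℝ r x - 1)).det = 0 := by
    intro x
    rw [add_sub_cancel]
    by_contra hne
    have hsurj := (LinearMap.equivOfDetNeZero (fderiv ℝ r x : E →ₗ[ℝ] E) hne).surjective
    obtain ⟨u, hu⟩ := hsurj (r x)
    have hu' : fderiv ℝ r x u = r x := hu
    have hd := ((hrd x).hasFDerivAt.inner ℝ (hrd x).hasFDerivAt)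
    have hconst : (fun t => inner ℝ (r t) (r t)) = fun _ => R ^ 2 := by
      ext t; rw [real_inner_self_eq_norm_sq, hrR]
    rw [hconst] at hd
    have := congrArg (fun l => l u) (hd.unique (hasFDerivAt_const _ _))
    simp [hu', hrR] at this
    exact hR.ne' this
  have hint : ∫ x in Metric.ball (0 : E) R, (1 + (fderiv ℝ r x - 1)).det
      = MeasureTheory.volume.real (Metric.ball (0 : E) R) := by
    rw [MeasureTheory.integral_congr_ae (Filter.Eventually.of_forall fun x => hpoly (fderiv ℝ r x - 1))]
    rw [MeasureTheory.integral_finsetSum]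
    · simp_rw [MeasureTheory.integral_const_mul, hvol]
      rw [← Finset.sum_mul, hw, one_mul]
    · intro i _
      have hc1 : Continuous fun x => v i • (fderiv ℝ r x - 1) := hcont.const_smul (v i)
      have hc2 : Continuous fun x => 1 + v i • (fderiv ℝ r x - 1) := continuous_const.add hc1
      have hc : Continuous fun x => w i * (1 + v i • (fderiv ℝ r x - 1)).det :=
        continuous_const.mul (ContinuousLinearMap.continuous_det.comp
          hc2)
      exact (hc.continuousOn.integrableOn_compact (isCompact_closedBall (0 : E) R)).mono_set
        Metric.ball_subset_closedBall
  simp only [hzero, MeasureTheory.integral_zero] at hint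
  have : 0 < MeasureTheory.volume.real (Metric.ball (0 : E) R) := by
    rw [MeasureTheory.measureReal_def]
    exact ENNReal.toReal_pos (Metric.measure_ball_pos _ _ hR).ne'
      MeasureTheory.measure_ball_lt_top.ne
  linarith

lemma aux_zero_smooth {E : Type*} [NormedAddCommGroup E] [InnerProductSpace ℝ E]
    [FiniteDimensional ℝ E] [MeasurableSpace E] [BorelSpace E]
    (G : E → E) (hG : ContDiff ℝ 1 G) (R : ℝ) (hR : 0 < R)
    (hid : ∀ x, ‖x‖ = R → G x = x) : ∃ x, G x = 0 := by
  by_contra! hne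
  refine aux_noretract (fun x => (R * ‖G x‖⁻¹) • G x) ?_ R hR ?_ ?_
  · exact (contDiff_const.mul ((hG.norm ℝ hne).inv fun x => norm_ne_zero_iff.mpr (hne x))).smul hG
  · intro x
    have := norm_pos_iff.mpr (hne x)
    rw [norm_smul, Real.norm_of_nonneg (by positivity)]
    field_simp
  · intro x hx
    simp only [hid x hx, hx]
    rw [mul_inv_cancel₀ hR.ne', one_smul]

lemma aux_zero_euclid {E : Type*} [NormedAddCommGroup E] [InnerProductSpace ℝ E]
    [FiniteDimensional ℝ E] [MeasurableSpace E] [BorelSpace E]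
    (h : E → E) (hh : Continuous h) (C : ℝ) (hC : ∀ x, ‖h x‖ ≤ C) : ∃ x, x + h x = 0 := by
  by_contra! hne
  have hC0 : 0 ≤ C := (norm_nonneg _).trans (hC 0)
  let χ : E → ℝ := fun x => max 0 (min 1 (C + 2 - ‖x‖))
  have hχc : Continuous χ := by fun_prop
  have hχ0 : ∀ x, 0 ≤ χ x := fun x => le_max_left _ _
  have hχ1 : ∀ x, χ x ≤ 1 := fun x => max_le zero_le_one (min_le_left _ _)
  let h1 : E → E := fun x => χ x • h x
  have h1c : Continuous h1 := hχc.smul hh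
  have h1b : ∀ x, ‖h1 x‖ ≤ C := by
    intro x
    simp only [h1]
    rw [norm_smul, Real.norm_of_nonneg (hχ0 x)]
    nlinarith [hC x, hχ0 x, hχ1 x, norm_nonneg (h x)]
  have h1ne : ∀ x, x + h1 x ≠ 0 := by
    intro x hx
    by_cases hxC : ‖x‖ ≤ C + 1
    · have : χ x = 1 := by
        simp only [χ]
        rw [min_eq_left (by linarith), max_eq_right zero_le_one]
      simp only [h1, this, one_smul] at hx
      exact hne x hx
    · have h2 : x = - h1 x := eq_neg_of_add_eq_zero_left hx
      have h3 := h1b x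
      rw [← norm_neg, ← h2] at h3
      linarith
  obtain ⟨g, hg, hgd, hgs⟩ := h1c.exists_contDiff_approx 1 (ε := fun x => ‖x + h1 x‖)
    (by fun_prop) (fun x => norm_pos_iff.mpr (h1ne x))
  obtain ⟨x, hx⟩ := aux_zero_smooth (fun x => x + g x) (contDiff_id.add hg) (C + 2) (by linarith) (by
    intro x hx
    have h0 : h1 x = 0 := by simp [h1, χ, hx]
    have : g x = 0 := by
      by_contra hgx
      exact hgs hgx h0
    simp [this])
  have h4 := hgd x
  rw [dist_comm, dist_eq_norm, ← add_sub_add_left_eq_sub (h1 x) (g x) x] at h4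
  rw [hx, sub_zero] at h4
  exact lt_irrefl _ h4

lemma aux_zero_s15 {Y : Type*} [NormedAddCommGroup Y] [NormedSpace ℝ Y] [FiniteDimensional ℝ Y]
    (h : Y → Y) (hh : Continuous h) (C : ℝ) (hC : ∀ x, ‖h x‖ ≤ C) : ∃ x, x + h x = 0 := by
  let φ := toEuclidean (E := Y)
  obtain ⟨x, hx⟩ := aux_zero_euclid (fun z => φ (h (φ.symm z)))
    (φ.continuous.comp (hh.comp φ.symm.continuous)) (‖φ.toContinuousLinearMap‖ * C) (fun z =>
      (φ.toContinuousLinearMap.le_opNorm _).trans (mul_le_mul_of_nonneg_left (hC _) (norm_nonneg _)))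
  refine ⟨φ.symm x, φ.injective ?_⟩
  rw [map_add, map_zero, φ.apply_symm_apply]
  exact hx

lemma aux_rpow_sub {a b α : ℝ} (ha : 0 ≤ a) (hb : 0 ≤ b) (hα0 : 0 < α) (hα1 : α ≤ 1) :
    |a ^ α - b ^ α| ≤ |a - b| ^ α := by
  wlog hab : b ≤ a generalizing a b
  · rw [abs_sub_comm, abs_sub_comm a b]; exact this hb ha (le_of_not_ge hab)
  rw [abs_of_nonneg (sub_nonneg.mpr (Real.rpow_le_rpow hb hab hα0.le)),
    abs_of_nonneg (sub_nonneg.mpr hab)]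
  have := Real.rpow_add_le_add_rpow (sub_nonneg.mpr hab) hb hα0.le hα1
  rw [sub_add_cancel] at this
  linarith

lemma aux_unit {X : Type*} [NormedAddCommGroup X] [NormedSpace ℝ X] {x : X} (hx : x ≠ 0) :
    ‖‖x‖⁻¹ • x‖ = 1 := by
  rw [norm_smul, norm_inv, norm_norm, inv_mul_cancel₀ (norm_ne_zero_iff.mpr hx)]

lemma aux_norm {X Y : Type*} [NormedAddCommGroup X] [NormedSpace ℝ X]
    [NormedAddCommGroup Y] [NormedSpace ℝ Y] (p : ℝ) (hp : 0 < p) (f : X → Y)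
    (hf : ∀ x : X, ‖x‖ = 1 → ‖f x‖ = 1) (x : X) : ‖radialExt p f x‖ = ‖x‖ ^ p := by
  unfold radialExt
  split_ifs with h
  · simp [h, Real.zero_rpow hp.ne']
  · rw [norm_smul, hf _ (aux_unit h), mul_one, Real.norm_of_nonneg (by positivity)]

lemma aux_holder_s15 {X Y : Type*} [NormedAddCommGroup X] [NormedSpace ℝ X]
    [NormedAddCommGroup Y] [NormedSpace ℝ Y] (α K : ℝ) (hα0 : 0 < α) (hα1 : α ≤ 1) (hK : 0 < K)
    (f : X → Y) (hf : ∀ x : X, ‖x‖ = 1 → ‖f x‖ = 1)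
    (hfK : ∀ x y : X, ‖x‖ = 1 → ‖y‖ = 1 → ‖f x - f y‖ ≤ K * ‖x - y‖ ^ α) (x y : X) :
    ‖radialExt α f x - radialExt α f y‖ ≤ (1 + K * 2 ^ α) * ‖x - y‖ ^ α := by
  have hK2 : 1 ≤ 1 + K * 2 ^ α := by
    have : 0 < K * (2 : ℝ) ^ α := by positivity
    linarith
  by_cases hx : x = 0
  · have h0 : radialExt α f x = 0 := by simp [radialExt, hx]
    rw [h0, zero_sub, norm_neg, aux_norm α hα0 f hf, hx, zero_sub, norm_neg]
    exact le_mul_of_one_le_left (by positivity) hK2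
  by_cases hy : y = 0
  · have h0 : radialExt α f y = 0 := by simp [radialExt, hy]
    rw [h0, sub_zero, aux_norm α hα0 f hf, hy, sub_zero]
    exact le_mul_of_one_le_left (by positivity) hK2
  have hx0 := norm_pos_iff.mpr hx
  have hy0 := norm_pos_iff.mpr hy
  have e : radialExt α f x - radialExt α f y
      = (‖x‖ ^ α - ‖y‖ ^ α) • f (‖x‖⁻¹ • x)
        + ‖y‖ ^ α • (f (‖x‖⁻¹ • x) - f (‖y‖⁻¹ • y)) := by
    simp only [radialExt, hx, hy, if_false]
    module
  have h1 : |‖x‖ ^ α - ‖y‖ ^ α| ≤ ‖x - y‖ ^ α :=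
    (aux_rpow_sub hx0.le hy0.le hα0 hα1).trans
      (Real.rpow_le_rpow (abs_nonneg _) (abs_norm_sub_norm_le x y) hα0.le)
  have h2 : ‖y‖ * ‖‖x‖⁻¹ • x - ‖y‖⁻¹ • y‖ ≤ 2 * ‖x - y‖ := by
    have e2 : ‖y‖ • (‖x‖⁻¹ • x - ‖y‖⁻¹ • y) = (x - y) + ((‖y‖ - ‖x‖) * ‖x‖⁻¹) • x := by
      rw [smul_sub, smul_smul, smul_smul, mul_inv_cancel₀ hy0.ne', sub_mul,
        mul_inv_cancel₀ hx0.ne']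
      module
    calc ‖y‖ * ‖‖x‖⁻¹ • x - ‖y‖⁻¹ • y‖ = ‖‖y‖ • (‖x‖⁻¹ • x - ‖y‖⁻¹ • y)‖ := by
          rw [norm_smul, norm_norm]
      _ ≤ ‖x - y‖ + ‖((‖y‖ - ‖x‖) * ‖x‖⁻¹) • x‖ := by rw [e2]; exact norm_add_le _ _
      _ = ‖x - y‖ + |‖y‖ - ‖x‖| := by
          rw [norm_smul, norm_mul, norm_inv, norm_norm, mul_assoc, inv_mul_cancel₀ hx0.ne', mul_one,
            Real.norm_eq_abs]
      _ ≤ 2 * ‖x - y‖ := by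
          have := abs_norm_sub_norm_le y x
          rw [norm_sub_rev] at this
          linarith
  have h3 : ‖y‖ ^ α * ‖f (‖x‖⁻¹ • x) - f (‖y‖⁻¹ • y)‖ ≤ K * 2 ^ α * ‖x - y‖ ^ α := by
    calc _ ≤ ‖y‖ ^ α * (K * ‖‖x‖⁻¹ • x - ‖y‖⁻¹ • y‖ ^ α) := by
          gcongr; exact hfK _ _ (aux_unit hx) (aux_unit hy)
      _ = K * (‖y‖ * ‖‖x‖⁻¹ • x - ‖y‖⁻¹ • y‖) ^ α := by
          rw [Real.mul_rpow hy0.le (norm_nonneg _)]; ring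
      _ ≤ K * (2 * ‖x - y‖) ^ α := by gcongr
      _ = _ := by rw [Real.mul_rpow (by norm_num) (norm_nonneg _)]; ring
  rw [e]
  calc _ ≤ ‖(‖x‖ ^ α - ‖y‖ ^ α) • f (‖x‖⁻¹ • x)‖
        + ‖‖y‖ ^ α • (f (‖x‖⁻¹ • x) - f (‖y‖⁻¹ • y))‖ := norm_add_le _ _
    _ = |‖x‖ ^ α - ‖y‖ ^ α| + ‖y‖ ^ α * ‖f (‖x‖⁻¹ • x) - f (‖y‖⁻¹ • y)‖ := by
        rw [norm_smul, norm_smul, hf _ (aux_unit hx), mul_one, Real.norm_eq_abs,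
          Real.norm_of_nonneg (by positivity : 0 ≤ ‖y‖ ^ α)]
    _ ≤ _ := by linarith

lemma aux_cont {X Y : Type*} [NormedAddCommGroup X] [NormedSpace ℝ X]
    [NormedAddCommGroup Y] [NormedSpace ℝ Y] (p : ℝ) (hp : 0 < p) (f : X → Y)
    (hf : ∀ x : X, ‖x‖ = 1 → ‖f x‖ = 1) (hc : ContinuousOn f {x | ‖x‖ = 1}) :
    Continuous (radialExt p f) := by
  rw [continuous_iff_continuousAt]
  intro x
  by_cases hx : x = 0
  · subst hx
    have h0 : radialExt p f 0 = 0 := by simp [radialExt]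
    rw [ContinuousAt, h0, tendsto_zero_iff_norm_tendsto_zero]
    simp_rw [aux_norm p hp f hf]
    have : Continuous fun x : X => ‖x‖ ^ p := continuous_norm.rpow_const fun _ => Or.inr hp.le
    simpa [Real.zero_rpow hp.ne'] using this.tendsto 0
  · have hx0 := norm_pos_iff.mpr hx
    have hev : radialExt p f =ᶠ[nhds x] fun z => ‖z‖ ^ p • f (‖z‖⁻¹ • z) := by
      filter_upwards [isOpen_ne.mem_nhds hx] with z hz
      simp only [radialExt, if_neg hz]
    refine ContinuousAt.congr ?_ hev.symm
    have h1 : ContinuousAt (fun z : X => ‖z‖ ^ p) x :=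
      continuous_norm.continuousAt.rpow_const (Or.inr hp.le)
    have h2 : ContinuousAt (fun z : X => ‖z‖⁻¹ • z) x :=
      (continuous_norm.continuousAt.inv₀ hx0.ne').smul continuousAt_id
    refine h1.smul ?_
    have h3 := hc (‖x‖⁻¹ • x) (aux_unit hx)
    refine Filter.Tendsto.comp h3 (tendsto_nhdsWithin_iff.mpr ⟨h2, ?_⟩)
    filter_upwards [isOpen_ne.mem_nhds hx] with z hz using aux_unit hz

lemma aux_right_inv {X Y : Type*} [NormedAddCommGroup X] [NormedSpace ℝ X]
    [NormedAddCommGroup Y] [NormedSpace ℝ Y] (α : ℝ) (hα : 0 < α) (f : X → Y) (finv : Y → X)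
    (hi : ∀ y : Y, ‖y‖ = 1 → ‖finv y‖ = 1) (hfi : ∀ y : Y, ‖y‖ = 1 → f (finv y) = y) (y : Y) :
    radialExt α f (radialExt (1 / α) finv y) = y := by
  by_cases hy : y = 0
  · simp [radialExt, hy]
  have hy0 := norm_pos_iff.mpr hy
  have hn := aux_norm (1 / α) (by positivity) finv hi y
  have hpos : 0 < ‖y‖ ^ (1 / α) := by positivity
  have hne : radialExt (1 / α) finv y ≠ 0 := by rw [← norm_pos_iff, hn]; exact hpos
  rw [radialExt, if_neg hne, hn, ← Real.rpow_mul hy0.le, one_div_mul_cancel hα.ne', Real.rpow_one]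
  have : (‖y‖ ^ (1 / α))⁻¹ • radialExt (1 / α) finv y = finv (‖y‖⁻¹ • y) := by
    rw [radialExt, if_neg hy, smul_smul, inv_mul_cancel₀ hpos.ne', one_smul]
  rw [this, hfi _ (aux_unit hy), smul_smul, mul_inv_cancel₀ hy0.ne', one_smul]

lemma aux_inv_cont {X Y : Type*} [NormedAddCommGroup X] [NormedSpace ℝ X]
    [NormedAddCommGroup Y] [NormedSpace ℝ Y] (β L : ℝ) (hβ : 0 < β) (hL : 0 < L)
    (f : X → Y) (finv : Y → X)
    (hi : ∀ y : Y, ‖y‖ = 1 → ‖finv y‖ = 1) (hfi : ∀ y : Y, ‖y‖ = 1 → f (finv y) = y)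
    (hl : ∀ x y : X, ‖x‖ = 1 → ‖y‖ = 1 → (1 / L) * ‖x - y‖ ^ (1 / β) ≤ ‖f x - f y‖) :
    ContinuousOn finv {y | ‖y‖ = 1} := by
  intro y hy
  have hb : ∀ z ∈ {z : Y | ‖z‖ = 1}, ‖finv z - finv y‖ ≤ (L * ‖z - y‖) ^ β := by
    intro z hz
    have h := hl (finv z) (finv y) (hi z hz) (hi y hy)
    rw [hfi z hz, hfi y hy, one_div_mul_eq_div, div_le_iff₀' hL] at h
    have h2 := Real.rpow_le_rpow (by positivity) h hβ.le
    rwa [← Real.rpow_mul (norm_nonneg _), one_div_mul_cancel hβ.ne', Real.rpow_one] at h2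
  rw [ContinuousWithinAt, tendsto_iff_norm_sub_tendsto_zero]
  refine squeeze_zero' (Filter.Eventually.of_forall fun _ => norm_nonneg _)
    (eventually_nhdsWithin_of_forall hb) ?_
  have hc : Continuous fun z : Y => (L * ‖z - y‖) ^ β :=
    (by fun_prop : Continuous fun z : Y => L * ‖z - y‖).rpow_const fun _ => Or.inr hβ.le
  have := (hc.tendsto y).mono_left (nhdsWithin_le_nhds (s := {z : Y | ‖z‖ = 1}))
  simpa [Real.zero_rpow hβ.ne'] using this

/-- For a bi-Hölder homeomorphism `f` between the unit spheres of finite-dimensional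
real normed spaces `X` and `Y`, with `f̃` its degree-`α` radial extension: for every
finite nonempty `P ⊆ X` there is a shift `t` with `(1/n) Σ_{x∈P} f̃(x - t) = 0`, and
every such `t` satisfies `‖t‖ ≤ ((M/n) Σ_{x∈P} ‖x‖^α)^{1/α}`, where `M` depends only
on `K, L, α, β`. -/
theorem stmt15 (α β K L : ℝ) (hα0 : 0 < α) (hα1 : α ≤ 1) (hβ0 : 0 < β) (hβ1 : β ≤ 1)
    (hK : 0 < K) (hL : 0 < L) :
    ∃ M : ℝ, 0 < M ∧
      ∀ (X : Type u) (Y : Type v)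
        [instX : NormedAddCommGroup X] [instX' : NormedSpace ℝ X]
        [instX'' : FiniteDimensional ℝ X]
        [instY : NormedAddCommGroup Y] [instY' : NormedSpace ℝ Y]
        [instY'' : FiniteDimensional ℝ Y]
        (f : X → Y) (finv : Y → X),
        (∀ x : X, ‖x‖ = 1 → ‖f x‖ = 1) →
        (∀ y : Y, ‖y‖ = 1 → ‖finv y‖ = 1) →
        (∀ x : X, ‖x‖ = 1 → finv (f x) = x) →
        (∀ y : Y, ‖y‖ = 1 → f (finv y) = y) →
        (∀ x y : X, ‖x‖ = 1 → ‖y‖ = 1 →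
          (1 / L) * ‖x - y‖ ^ (1 / β) ≤ ‖f x - f y‖ ∧ ‖f x - f y‖ ≤ K * ‖x - y‖ ^ α) →
        ∀ (P : Finset X), P.Nonempty →
          (∃ t : X, (P.card : ℝ)⁻¹ • ∑ x ∈ P, radialExt α f (x - t) = 0) ∧
          (∀ t : X, (P.card : ℝ)⁻¹ • ∑ x ∈ P, radialExt α f (x - t) = 0 →
            ‖t‖ ≤ ((M / (P.card : ℝ)) * ∑ x ∈ P, ‖x‖ ^ α) ^ (1 / α)) := by
  refine ⟨1 + K * 2 ^ α, by positivity, ?_⟩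
  intro X Y _ _ _ _ _ _ f finv hf hi hif hfi hfK P hP
  have hH := aux_holder_s15 α K hα0 hα1 hK f hf (fun x y hx hy => (hfK x y hx hy).2)
  have hn : 0 < (P.card : ℝ) := by exact_mod_cast hP.card_pos
  -- the average differs from `f̃(s)` by a bounded amount
  have hb : ∀ s : X, ‖(P.card : ℝ)⁻¹ • ∑ x ∈ P, radialExt α f (x + s) - radialExt α f s‖
      ≤ ((1 + K * 2 ^ α) / (P.card : ℝ)) * ∑ x ∈ P, ‖x‖ ^ α := by
    intro s
    have e : (P.card : ℝ)⁻¹ • ∑ x ∈ P, radialExt α f (x + s) - radialExt α f s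
        = (P.card : ℝ)⁻¹ • ∑ x ∈ P, (radialExt α f (x + s) - radialExt α f s) := by
      rw [Finset.sum_sub_distrib, Finset.sum_const, smul_sub, ← Nat.cast_smul_eq_nsmul ℝ,
        smul_smul, inv_mul_cancel₀ hn.ne', one_smul]
    rw [e, norm_smul, norm_inv, Real.norm_of_nonneg hn.le, div_eq_inv_mul, mul_assoc,
      Finset.mul_sum]
    refine mul_le_mul_of_nonneg_left ((norm_sum_le _ _).trans (Finset.sum_le_sum fun x _ => ?_))
      (by positivity)
    simpa using hH (x + s) s
  have hfc : Continuous (radialExt α f) := by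
    refine aux_cont α hα0 f hf fun y hy => ?_
    rw [ContinuousWithinAt, tendsto_iff_norm_sub_tendsto_zero]
    refine squeeze_zero' (Filter.Eventually.of_forall fun _ => norm_nonneg _)
      (eventually_nhdsWithin_of_forall fun z hz => (hfK z y hz hy).2) ?_
    have hc : Continuous fun z : X => K * ‖z - y‖ ^ α :=
      continuous_const.mul
        ((by fun_prop : Continuous fun z : X => ‖z - y‖).rpow_const fun _ => Or.inr hα0.le)
    have := (hc.tendsto y).mono_left (nhdsWithin_le_nhds (s := {z : X | ‖z‖ = 1}))
    simpa [Real.zero_rpow hα0.ne'] using this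
  have hgc : Continuous (radialExt (1 / α) finv) :=
    aux_cont (1 / α) (by positivity) finv hi
      (aux_inv_cont β L hβ0 hL f finv hi hfi fun x y hx hy => (hfK x y hx hy).1)
  have hr := aux_right_inv α hα0 f finv hi hfi
  constructor
  · obtain ⟨y, hy⟩ := aux_zero_s15
      (fun y => (P.card : ℝ)⁻¹ • ∑ x ∈ P, radialExt α f (x + radialExt (1 / α) finv y) - y)
      (((continuous_finsetSum P fun x _ => hfc.comp (continuous_const.add hgc)).const_smul _).sub
        continuous_id) _ (fun y => by
          have := hb (radialExt (1 / α) finv y)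
          rwa [hr] at this)
    refine ⟨-radialExt (1 / α) finv y, ?_⟩
    simp only [sub_neg_eq_add]
    rwa [add_sub_cancel] at hy
  · intro t ht
    have h := hb (-t)
    simp only [← sub_eq_add_neg] at h
    rw [ht, zero_sub, norm_neg, aux_norm α hα0 f hf, norm_neg] at h
    have h2 := Real.rpow_le_rpow (by positivity) h (by positivity : 0 ≤ 1 / α)
    rwa [← Real.rpow_mul (norm_nonneg _), mul_one_div_cancel hα0.ne', Real.rpow_one] at h2
end
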